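/- Let A be a dyadic interval in ℝ/ℤ and let M ≥ 2 be an integer. (i) If A = B₁ ∪ B₂ ∪ … ∪ B_M is a subdivision of A into M consecutive dyadic intervals (listed in positive order, with consecutive pieces sharing exactly one endpoint and otherwise disjoint interiors), then the ratio of arc lengths |B₁|/|A| belongs to {1/2^j : j = 1,…,M−1}. (ii) Conversely, for every a ∈ {1/2^j : j = 1,…,M−1} there exists such a subdivision A = B₁ ∪ … ∪ B_M into M consecutive dyadic intervals with |B₁|/|A| = a. -/

import Mathlib

noncomputable section

open Set

/-- The circle `ℝ/ℤ`. -/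
abbrev 𝕊 : Type := AddCircle (1 : ℝ)

/-- The natural projection from `ℝ` to the circle `ℝ/ℤ`. -/
def tc (x : ℝ) : 𝕊 := (x : 𝕊)

/-- The closed arc on the circle from `a` to `b`, traversed in the positive direction;
arcs are parametrized by real lifts `a ≤ b ≤ a + 1` of their endpoints. -/
def cArc (a b : ℝ) : Set 𝕊 := tc '' Set.Icc a b

/-- The open arc on the circle from `a` to `b` (the interior of `cArc a b`). -/
def oArc (a b : ℝ) : Set 𝕊 := tc '' Set.Ioo a b

/-- The multiplication-by-`d` map `σ_d : ℝ/ℤ → ℝ/ℤ`, `σ_d t = d·t`. -/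
def sigmaC (d : ℕ) (x : 𝕊) : 𝕊 := d • x

/-- A real number is a dyadic rational. -/
def IsDyadicR (x : ℝ) : Prop := ∃ (p : ℤ) (n : ℕ), x = p / 2 ^ n

/-- The exponent of the reduced-form denominator of a dyadic rational. -/
def dyadicLevel (x : ℝ) : ℕ := sInf {n : ℕ | ∃ p : ℤ, x = p / 2 ^ n}

/-- The reduced-form denominator of a dyadic rational. -/
def dyadicDenom (x : ℝ) : ℕ := 2 ^ dyadicLevel x

/-- The arc `[a,b]` of the circle `ℝ/ℤ` is a dyadic interval: its endpoints are dyadic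
rationals, and every dyadic rational in the open arc `(a,b)` has reduced-form denominator
strictly greater than the reduced-form denominators of both endpoints. -/
structure IsDyadicInterval (a b : ℝ) : Prop where
  lt : a < b
  le : b ≤ a + 1
  dyA : IsDyadicR a
  dyB : IsDyadicR b
  denom : ∀ x ∈ Set.Ioo a b, IsDyadicR x →
    dyadicDenom a < dyadicDenom x ∧ dyadicDenom b < dyadicDenom x

/-- `x 0 = a, x 1, …, x M = b` parametrizes a subdivision of the arc `[a,b]` into `M`
consecutive dyadic intervals (listed in positive order, consecutive pieces sharing exactly
one endpoint and otherwise having disjoint interiors). -/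
def IsDyadicSubdivision (a b : ℝ) (M : ℕ) (x : ℕ → ℝ) : Prop :=
  x 0 = a ∧ x M = b ∧ ∀ i < M, IsDyadicInterval (x i) (x (i + 1))

theorem IsDyadicR.dyadicLevel_le_iff {x : ℝ} (hx : IsDyadicR x) {n : ℕ} :
    dyadicLevel x ≤ n ↔ ∃ p : ℤ, x = p / 2 ^ n := by
  constructor
  · intro h
    have hne : {n : ℕ | ∃ p : ℤ, x = p / 2 ^ n}.Nonempty := by
      obtain ⟨p, k, hp⟩ := hx
      exact ⟨k, p, hp⟩
    obtain ⟨p, hp⟩ : ∃ p : ℤ, x = p / 2 ^ dyadicLevel x := Nat.sInf_mem hne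
    obtain ⟨k, hk⟩ := Nat.exists_eq_add_of_le h
    refine ⟨p * 2 ^ k, ?_⟩
    rw [hk, pow_add]
    push_cast
    rw [mul_div_mul_right _ _ (by positivity)]
    exact hp
  · rintro ⟨p, hp⟩
    exact Nat.sInf_le ⟨p, hp⟩

theorem isDyadicInterval_iff {a b : ℝ} :
    IsDyadicInterval a b ↔ ∃ (p : ℤ) (n : ℕ), a = p / 2 ^ n ∧ b = (p + 1) / 2 ^ n := by
  constructor
  · intro h
    obtain ⟨n, hn⟩ : ∃ n, n = max (dyadicLevel a) (dyadicLevel b) := ⟨_, rfl⟩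
    obtain ⟨p, hp⟩ := (h.dyA.dyadicLevel_le_iff (n := n)).1 (by omega)
    obtain ⟨q, hq⟩ := (h.dyB.dyadicLevel_le_iff (n := n)).1 (by omega)
    have hpos : (0 : ℝ) < 2 ^ n := by positivity
    have hpq : p < q := by
      have := h.lt
      rw [hp, hq, div_lt_div_iff_of_pos_right hpos] at this
      exact_mod_cast this
    have hqp : q ≤ p + 1 := by
      by_contra! hlt
      have hlt' : (p : ℝ) + 1 < q := by exact_mod_cast hlt
      have hmem : ((p + 1 : ℤ) : ℝ) / 2 ^ n ∈ Set.Ioo a b := by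
        rw [hp, hq]
        push_cast
        exact ⟨by gcongr; linarith, by gcongr⟩
      have hdy : IsDyadicR (((p + 1 : ℤ) : ℝ) / 2 ^ n) := ⟨_, _, rfl⟩
      have hden := h.denom _ hmem hdy
      simp only [dyadicDenom, Nat.pow_lt_pow_iff_right (by norm_num : 1 < 2)] at hden
      have := hdy.dyadicLevel_le_iff.2 ⟨_, rfl⟩
      omega
    obtain rfl : q = p + 1 := by omega
    exact ⟨p, n, hp, by rw [hq]; push_cast; rfl⟩
  · rintro ⟨p, n, rfl, rfl⟩
    have hpos : (0 : ℝ) < 2 ^ n := by positivity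
    have ha : IsDyadicR ((p : ℝ) / 2 ^ n) := ⟨_, _, rfl⟩
    have hb : IsDyadicR (((p : ℝ) + 1) / 2 ^ n) := ⟨p + 1, n, by push_cast; rfl⟩
    refine ⟨by gcongr; linarith, ?_, ha, hb, ?_⟩
    · rw [add_div]
      gcongr
      rw [div_le_one hpos]
      exact one_le_pow₀ (by norm_num)
    · rintro x ⟨hx1, hx2⟩ hx
      have hlev : n < dyadicLevel x := by
        by_contra! hle
        obtain ⟨q, rfl⟩ := hx.dyadicLevel_le_iff.1 hle
        rw [div_lt_div_iff_of_pos_right hpos] at hx1 hx2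
        have h1 : p < q := by exact_mod_cast hx1
        have h2 : q < p + 1 := by exact_mod_cast hx2
        omega
      have hla := ha.dyadicLevel_le_iff.2 ⟨p, rfl⟩
      have hlb := hb.dyadicLevel_le_iff (n := n).2 ⟨p + 1, by push_cast; rfl⟩
      simp only [dyadicDenom, Nat.pow_lt_pow_iff_right (by norm_num : 1 < 2)]
      omega

theorem IsDyadicInterval.left_half {a b : ℝ} (h : IsDyadicInterval a b) :
    IsDyadicInterval a ((a + b) / 2) := by
  obtain ⟨p, n, rfl, rfl⟩ := isDyadicInterval_iff.1 h
  refine isDyadicInterval_iff.2 ⟨2 * p, n + 1, ?_, ?_⟩ <;> push_cast <;> field_simp <;> ring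

theorem IsDyadicInterval.right_half {a b : ℝ} (h : IsDyadicInterval a b) :
    IsDyadicInterval ((a + b) / 2) b := by
  obtain ⟨p, n, rfl, rfl⟩ := isDyadicInterval_iff.1 h
  refine isDyadicInterval_iff.2 ⟨2 * p + 1, n + 1, ?_, ?_⟩ <;> push_cast <;> field_simp <;> ring

/-- A dyadic interval lying in `[a, b]` but not starting at `a` is no longer than the gap
between `a` and its left endpoint. -/
theorem IsDyadicInterval.sub_le_of_subinterval {a b c d : ℝ} (h : IsDyadicInterval a b)
    (h' : IsDyadicInterval c d) (hac : a < c) (hdb : d ≤ b) : d - c ≤ c - a := by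
  obtain ⟨p, n, rfl, rfl⟩ := isDyadicInterval_iff.1 h
  obtain ⟨q, k, rfl, rfl⟩ := isDyadicInterval_iff.1 h'
  have hlen : (1 : ℝ) / 2 ^ k ≤ 1 / 2 ^ n := by
    rw [add_div] at hdb
    rw [add_div] at hdb
    linarith
  have hnk : n ≤ k := by
    rw [one_div_le_one_div (by positivity) (by positivity)] at hlen
    exact (pow_le_pow_iff_right₀ (by norm_num)).1 hlen
  obtain ⟨e, rfl⟩ := Nat.exists_eq_add_of_le hnk
  have hp : (p : ℝ) / 2 ^ n = ((p * 2 ^ e : ℤ) : ℝ) / 2 ^ (n + e) := by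
    rw [pow_add]
    push_cast
    rw [mul_div_mul_right _ _ (by positivity)]
  rw [hp] at hac ⊢
  rw [div_lt_div_iff_of_pos_right (by positivity)] at hac
  have hpq : p * 2 ^ e + 1 ≤ q := by exact_mod_cast hac
  have hpq' : ((p * 2 ^ e : ℤ) : ℝ) + 1 ≤ q := by exact_mod_cast hpq
  rw [← sub_div, ← sub_div, div_le_div_iff_of_pos_right (by positivity)]
  linarith

theorem IsDyadicSubdivision.le_right {a b : ℝ} {M : ℕ} {x : ℕ → ℝ}
    (h : IsDyadicSubdivision a b M x) {i : ℕ} (hi : i ≤ M) : x i ≤ b := by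
  induction hi using Nat.decreasingInduction with
  | self => exact h.2.1.le
  | of_succ k hk ih => exact (h.2.2 k hk).lt.le.trans ih

theorem IsDyadicSubdivision.left_lt {a b : ℝ} {M : ℕ} {x : ℕ → ℝ}
    (h : IsDyadicSubdivision a b M x) (i : ℕ) (hi : i < M) : a < x (i + 1) := by
  induction i with
  | zero => simpa [h.1] using (h.2.2 0 hi).lt
  | succ k ih => exact (ih (by omega)).trans (h.2.2 _ hi).lt

theorem IsDyadicSubdivision.sub_left_le {a b : ℝ} {M : ℕ} {x : ℕ → ℝ}
    (h : IsDyadicSubdivision a b M x) (hA : IsDyadicInterval a b) (i : ℕ) (hi : i < M) :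
    x (i + 1) - a ≤ 2 ^ i * (x 1 - a) := by
  induction i with
  | zero => simp
  | succ k ih =>
    have h1 := hA.sub_le_of_subinterval (h.2.2 _ hi) (h.left_lt k (by omega))
      (h.le_right (by omega))
    have h2 := ih (by omega)
    rw [pow_succ]
    linarith

theorem IsDyadicSubdivision.exists_ratio_eq {a b : ℝ} {M : ℕ} {x : ℕ → ℝ}
    (h : IsDyadicSubdivision a b M x) (hA : IsDyadicInterval a b) (hM : 2 ≤ M) :
    ∃ j : ℕ, 1 ≤ j ∧ j ≤ M - 1 ∧ (x 1 - x 0) / (b - a) = 1 / 2 ^ j := by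
  have hlast := h.sub_left_le hA (M - 1) (by omega)
  rw [Nat.sub_add_cancel (by omega), h.2.1] at hlast
  have hlt : x 1 < b := (h.2.2 1 (by omega)).lt.trans_le (h.le_right (by omega))
  have hfirst := h.2.2 0 (by omega)
  rw [h.1] at hfirst ⊢
  obtain ⟨p, n, hp, hp'⟩ := isDyadicInterval_iff.1 hA
  obtain ⟨q, m, hq, hq'⟩ := isDyadicInterval_iff.1 hfirst
  have hba : b - a = 1 / 2 ^ n := by rw [hp, hp']; ring
  have hxa : x 1 - a = 1 / 2 ^ m := by rw [zero_add] at hq'; rw [hq, hq']; ring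
  have hnm : n < m := by
    have : (1 : ℝ) / 2 ^ m < 1 / 2 ^ n := by linarith
    rw [one_div_lt_one_div (by positivity) (by positivity)] at this
    exact (pow_lt_pow_iff_right₀ (by norm_num)).1 this
  obtain ⟨j, rfl⟩ := Nat.exists_eq_add_of_le hnm.le
  refine ⟨j, by omega, ?_, ?_⟩
  · rw [hba, hxa, pow_add] at hlast
    have : (2 : ℝ) ^ j ≤ 2 ^ (M - 1) := by
      field_simp at hlast
      exact hlast
    exact (pow_le_pow_iff_right₀ (by norm_num)).1 this
  · rw [hba, hxa, pow_add]
    field_simp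

theorem IsDyadicSubdivision.cons {a b c : ℝ} {M : ℕ} {x : ℕ → ℝ}
    (h : IsDyadicSubdivision c b M x) (hac : IsDyadicInterval a c) :
    IsDyadicSubdivision a b (M + 1) (fun i => Nat.casesOn i a x) := by
  refine ⟨rfl, h.2.1, ?_⟩
  rintro (_ | i) hi
  · simpa [h.1] using hac
  · exact h.2.2 i (by omega)

theorem IsDyadicSubdivision.snoc {a b c : ℝ} {M : ℕ} {x : ℕ → ℝ}
    (h : IsDyadicSubdivision a c M x) (hcb : IsDyadicInterval c b) :
    IsDyadicSubdivision a b (M + 1) (fun i => if i ≤ M then x i else b) := by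
  refine ⟨by simp [h.1], by simp, fun i hi => ?_⟩
  rcases (Nat.lt_succ_iff.1 hi).lt_or_eq with hlt | rfl
  · simpa [hlt.le, Nat.succ_le_of_lt hlt] using h.2.2 i hlt
  · simpa [h.2.1] using hcb

theorem isDyadicSubdivision_two {a b : ℝ} (h : IsDyadicInterval a b) :
    ∃ x : ℕ → ℝ, IsDyadicSubdivision a b 2 x ∧ (x 1 - x 0) / (b - a) = 1 / 2 := by
  have hone : IsDyadicSubdivision ((a + b) / 2) b 1
      (fun i => Nat.casesOn i ((a + b) / 2) fun _ => b) := by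
    refine ⟨rfl, rfl, fun i hi => ?_⟩
    obtain rfl : i = 0 := by omega
    exact h.right_half
  refine ⟨_, hone.cons h.left_half, ?_⟩
  have : b - a ≠ 0 := sub_ne_zero.2 h.lt.ne'
  change ((a + b) / 2 - a) / (b - a) = 1 / 2
  field_simp
  ring

theorem exists_isDyadicSubdivision_ratio_eq {M : ℕ} (hM : 2 ≤ M) :
    ∀ {a b : ℝ}, IsDyadicInterval a b → ∀ j : ℕ, 1 ≤ j → j ≤ M - 1 →
      ∃ x : ℕ → ℝ, IsDyadicSubdivision a b M x ∧ (x 1 - x 0) / (b - a) = 1 / 2 ^ j := by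
  induction M, hM using Nat.le_induction with
  | base =>
    intro a b h j hj hj'
    obtain rfl : j = 1 := by omega
    simpa using isDyadicSubdivision_two h
  | succ M hM ih =>
    intro a b h j hj hj'
    have hne : b - a ≠ 0 := sub_ne_zero.2 h.lt.ne'
    obtain rfl | ⟨k, hk, rfl⟩ : j = 1 ∨ ∃ k, 1 ≤ k ∧ j = k + 1 := by
      rcases hj.eq_or_lt with h1 | h1
      · exact .inl h1.symm
      · exact .inr ⟨j - 1, by omega, by omega⟩
    · obtain ⟨x, hx, -⟩ := ih h.right_half 1 le_rfl (by omega)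
      refine ⟨_, hx.cons h.left_half, ?_⟩
      change (x 0 - a) / (b - a) = _
      rw [hx.1]
      field_simp
      ring
    · obtain ⟨x, hx, hr⟩ := ih h.left_half k hk (by omega)
      refine ⟨_, hx.snoc h.right_half, ?_⟩
      have hhalf : (a + b) / 2 - a = (b - a) / 2 := by ring
      rw [hhalf, div_eq_iff (by positivity)] at hr
      simp only [show 1 ≤ M by omega, Nat.zero_le, if_true]
      rw [hr, pow_succ]
      field_simp

/-- Let `A = [a,b]` be a dyadic interval and `M ≥ 2`. (i) For every subdivision of `A` into
`M` consecutive dyadic intervals `B₁, …, B_M`, the ratio `|B₁|/|A|` of arc lengths belongs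
to `{1/2^j : j = 1, …, M-1}`. (ii) Conversely, every value in `{1/2^j : j = 1, …, M-1}` is
realized as `|B₁|/|A|` for some such subdivision. -/
theorem dyadicInterval_subdivision_ratio (a b : ℝ) (hA : IsDyadicInterval a b)
    (M : ℕ) (hM : 2 ≤ M) :
    (∀ x : ℕ → ℝ, IsDyadicSubdivision a b M x →
        ∃ j : ℕ, 1 ≤ j ∧ j ≤ M - 1 ∧ (x 1 - x 0) / (b - a) = 1 / 2 ^ j) ∧
    (∀ j : ℕ, 1 ≤ j → j ≤ M - 1 →
        ∃ x : ℕ → ℝ, IsDyadicSubdivision a b M x ∧ (x 1 - x 0) / (b - a) = 1 / 2 ^ j) := by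
  exact ⟨fun _ hx => hx.exists_ratio_eq hA hM, exists_isDyadicSubdivision_ratio_eq hM hA⟩
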